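/- For every positive integer n and every real a ≠ 0, the generalized Rayleigh system R_a has exactly one limit cycle: there exists a periodic orbit Γ which is a limit cycle, and any two limit cycles of R_a are equal as subsets of ℝ². -/

import Mathlib

/-- `(x, y)` is a solution of the generalized Rayleigh system
`ẋ = y`, `ẏ = -x + a (1 - y^(2n)) y`. -/
def IsSolRayleigh (n : ℕ) (a : ℝ) (x y : ℝ → ℝ) : Prop :=
  ∀ t : ℝ, HasDerivAt x (y t) t ∧
    HasDerivAt y (-x t + a * (1 - (y t) ^ (2 * n)) * y t) t

/-- `(x, y)` is a periodic (nonconstant) solution of the generalized Rayleigh system. -/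
def IsPeriodicSolRayleigh (n : ℕ) (a : ℝ) (x y : ℝ → ℝ) : Prop :=
  IsSolRayleigh n a x y ∧
  (∃ t₁ t₂ : ℝ, (x t₁, y t₁) ≠ (x t₂, y t₂)) ∧
  ∃ T : ℝ, 0 < T ∧ ∀ t : ℝ, (x (t + T), y (t + T)) = (x t, y t)

/-- `Γ` is a periodic orbit of the generalized Rayleigh system: the image in `ℝ²`
of a periodic solution. -/
def IsPeriodicOrbitRayleigh (n : ℕ) (a : ℝ) (Γ : Set (ℝ × ℝ)) : Prop :=
  ∃ x y : ℝ → ℝ, IsPeriodicSolRayleigh n a x y ∧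
    Γ = Set.range (fun t : ℝ => (x t, y t))

/-- `Γ` is a limit cycle of the generalized Rayleigh system: a periodic orbit having
an open neighborhood `U` in which it is the only periodic orbit. -/
def IsLimitCycleRayleigh (n : ℕ) (a : ℝ) (Γ : Set (ℝ × ℝ)) : Prop :=
  IsPeriodicOrbitRayleigh n a Γ ∧
  ∃ U : Set (ℝ × ℝ), IsOpen U ∧ Γ ⊆ U ∧
    ∀ Γ' : Set (ℝ × ℝ), IsPeriodicOrbitRayleigh n a Γ' → Γ' ⊆ U → Γ' = Γ

open Set Filter Topology
open scoped NNReal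


theorem ray_global_ode (f : ℝ → ℝ → ℝ) (K L : ℝ≥0) (hK : ∀ t, LipschitzWith K (f t))
    (hc : ∀ x, Continuous (fun t => f t x)) (hL : ∀ t x, |f t x| ≤ L) (x₀ : ℝ) :
    ∃ α : ℝ → ℝ, α 0 = x₀ ∧ ∀ t, HasDerivAt α (f t (α t)) t := by
  have key : ∀ N : ℕ, ∃ α : ℝ → ℝ, α 0 = x₀ ∧
      ∀ t ∈ Ioo (-((N : ℝ) + 1)) ((N : ℝ) + 1), HasDerivAt α (f t (α t)) t := by
    intro N
    have h0 : (0 : ℝ) ∈ Icc (-((N : ℝ) + 1)) ((N : ℝ) + 1) := by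
      constructor <;> [linarith [Nat.cast_nonneg (α := ℝ) N]; positivity]
    have hpl : IsPicardLindelof f (⟨0, h0⟩ : Icc (-((N : ℝ) + 1)) ((N : ℝ) + 1)) x₀
        (L * ((N : ℝ≥0) + 1)) 0 L K := by
      constructor
      · intro t _; exact (hK t).lipschitzOnWith
      · intro x _; exact (hc x).continuousOn
      · intro t _ x _; simpa using hL t x
      · simp
    obtain ⟨α, h1, h2⟩ := hpl.exists_eq_forall_mem_Icc_hasDerivWithinAt₀
    exact ⟨α, h1, fun t ht => (h2 t (Ioo_subset_Icc_self ht)).hasDerivAt (Icc_mem_nhds ht.1 ht.2)⟩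
  choose α h0 hα using key
  have agree : ∀ N M : ℕ, N ≤ M → ∀ t : ℝ, |t| < N + 1 → α N t = α M t := by
    intro N M hNM t ht
    have hNM' : (N : ℝ) ≤ M := by exact_mod_cast hNM
    have := ODE_solution_unique_of_mem_Ioo (v := f) (K := K) (s := fun _ => univ)
      (a := -((N : ℝ) + 1)) (b := (N : ℝ) + 1) (t₀ := 0) (f := α N) (g := α M)
      (fun t _ => (hK t).lipschitzOnWith)
      ⟨by linarith [Nat.cast_nonneg (α := ℝ) N], by positivity⟩
      (fun t ht => ⟨hα N t ht, trivial⟩)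
      (fun t ht => ⟨hα M t ⟨by linarith [ht.1], by linarith [ht.2]⟩, trivial⟩)
      (by rw [h0, h0])
    exact this (abs_lt.mp ht)
  refine ⟨fun t => α ⌈|t|⌉₊ t, h0 _, fun t => ?_⟩
  have hev : (fun u => α ⌈|u|⌉₊ u) =ᶠ[𝓝 t] α (⌈|t|⌉₊ + 1) := by
    have : ∀ᶠ u in 𝓝 t, |u| < |t| + 1 :=
      (continuous_abs.tendsto t).eventually (gt_mem_nhds (by linarith))
    filter_upwards [this] with u hu
    apply agree
    · apply Nat.ceil_le.mpr
      push_cast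
      linarith [Nat.le_ceil |t|]
    · linarith [Nat.le_ceil |u|]
  have ht : α ⌈|t|⌉₊ t = α (⌈|t|⌉₊ + 1) t := hev.eq_of_nhds
  have := hα (⌈|t|⌉₊ + 1) t (by
    apply abs_lt.mp; push_cast; linarith [Nat.le_ceil |t|])
  simp only
  rw [ht]
  exact this.congr_of_eventuallyEq hev

/-- Two simultaneous barriers. -/
theorem ray_barrier (u v u' v' : ℝ → ℝ) (b k l : ℝ)
    (hu : ∀ t, HasDerivAt u (u' t) t ) (hv : ∀ t, HasDerivAt v (v' t) t)
    (hu0 : u 0 ≤ k) (hv0 : v 0 ≤ l)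
    (h1 : ∀ t ∈ Ico 0 b, u t = k → v t ≤ l → u' t < 0)
    (h2 : ∀ t ∈ Ico 0 b, u t ≤ k → v t = l → v' t < 0) :
    ∀ t ∈ Icc 0 b, u t ≤ k ∧ v t ≤ l := by
  have hcu : Continuous u := continuous_iff_continuousAt.2 fun t => (hu t).continuousAt
  have hcv : Continuous v := continuous_iff_continuousAt.2 fun t => (hv t).continuousAt
  have aux : ∀ (w : ℝ → ℝ) (w' c x : ℝ), HasDerivAt w w' x → (w x < c ∨ (w x = c ∧ w' < 0)) →
      ∀ᶠ t in 𝓝[>] x, w t ≤ c := by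
    intro w w' c x hw h
    rcases h with h | ⟨h, h'⟩
    · have := hw.continuousAt.eventually (gt_mem_nhds h)
      exact (this.filter_mono nhdsWithin_le_nhds).mono fun _ h => le_of_lt h
    · have hs := (hasDerivAt_iff_tendsto_slope.1 hw).eventually (gt_mem_nhds h')
      have hs' : ∀ᶠ t in 𝓝[>] x, slope w x t < 0 :=
        hs.filter_mono (nhdsWithin_mono _ (fun y hy => ne_of_gt hy))
      filter_upwards [hs', self_mem_nhdsWithin] with t ht hxt
      have hxt' : 0 < t - x := sub_pos.2 hxt
      rw [slope_def_field, div_lt_iff₀ hxt'] at ht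
      linarith
  have : Icc 0 b ⊆ {t | u t ≤ k ∧ v t ≤ l} := by
    apply IsClosed.Icc_subset_of_forall_exists_gt
    · exact ((isClosed_le hcu continuous_const).inter
        (isClosed_le hcv continuous_const)).inter isClosed_Icc
    · exact ⟨hu0, hv0⟩
    · rintro x ⟨⟨hxu, hxv⟩, hx⟩ y hy
      have e1 := aux u _ k x (hu x) (by
        rcases hxu.lt_or_eq with h | h
        · exact Or.inl h
        · exact Or.inr ⟨h, h1 x hx h hxv⟩)
      have e2 := aux v _ l x (hv x) (by
        rcases hxv.lt_or_eq with h | h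
        · exact Or.inl h
        · exact Or.inr ⟨h, h2 x hx hxu h⟩)
      have e3 : ∀ᶠ t in 𝓝[>] x, t ∈ Ioc x y := Ioc_mem_nhdsGT hy
      obtain ⟨t, ht1, ht2, ht3⟩ := (e1.and (e2.and e3)).exists
      exact ⟨t, ⟨ht1, ht2⟩, ht3⟩
  exact this

theorem ray_poly_bound (n : ℕ) (hn : 0 < n) (a : ℝ) (ha : 0 < a) :
    ∃ C : ℝ, 0 < C ∧ ∀ Y : ℝ, 0 ≤ Y →
      (a + 1) * Y ^ 2 - a * (Y ^ 2 * Y ^ (2 * n)) + a / 2 * (Y * (1 + Y ^ (2 * n))) ≤ C := by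
  set M : ℝ := 2 + 1 / a with hM
  have hM0 : 0 < M := by positivity
  refine ⟨(a + 1) * M ^ 2 + a / 2 * (M * (1 + M ^ (2 * n))), by positivity, fun Y hY => ?_⟩
  rcases le_total Y M with h | h
  · have h1 : (a + 1) * Y ^ 2 ≤ (a + 1) * M ^ 2 := by gcongr
    have h2 : a / 2 * (Y * (1 + Y ^ (2 * n))) ≤ a / 2 * (M * (1 + M ^ (2 * n))) := by gcongr
    have h3 : 0 ≤ a * (Y ^ 2 * Y ^ (2 * n)) := by positivity
    linarith
  · have h1 : 1 ≤ Y := by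
      have : 0 < 1 / a := by positivity
      linarith
    have hP : 1 ≤ Y ^ (2 * n) := one_le_pow₀ h1
    have h4 : 2 * a + 1 ≤ a * Y := by
      have : a * M = 2 * a + 1 := by rw [hM]; field_simp
      nlinarith
    have hYP : Y ≤ Y ^ (2 * n) := le_self_pow₀ h1 (by omega)
    have h5 : (a + 1) * Y ^ 2 ≤ (a + 1) * (Y * Y ^ (2 * n)) := by rw [pow_two]; gcongr
    have h6 : a / 2 * Y ≤ a / 2 * (Y * Y ^ (2 * n)) := by
      have : Y * 1 ≤ Y * Y ^ (2 * n) := by gcongr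
      have := mul_le_mul_of_nonneg_left this (by positivity : 0 ≤ a / 2)
      linarith
    have h7 : 0 ≤ (Y * Y ^ (2 * n)) * (a * Y - (2 * a + 1)) :=
      mul_nonneg (by positivity) (by linarith)
    have h8 : 0 ≤ (a + 1) * M ^ 2 + a / 2 * (M * (1 + M ^ (2 * n))) := by positivity
    nlinarith

theorem ray_u_neg (n : ℕ) (a C r q c : ℝ) (ha : 0 < a) (hr : 1 ≤ r) (hqc : q ^ 2 + c ^ 2 = 1)
    (hC : ∀ Y : ℝ, 0 ≤ Y →
      (a + 1) * Y ^ 2 - a * (Y ^ 2 * Y ^ (2 * n)) + a / 2 * (Y * (1 + Y ^ (2 * n))) ≤ C)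
    (hrC : 2 * C < r) (hD : 0 < 1 + a * q * c * (1 - (r * q) ^ (2 * n))) :
    r * (a * q ^ 2 * (1 - (r * q) ^ (2 * n))) / (1 + a * q * c * (1 - (r * q) ^ (2 * n)))
      - (c ^ 2 - q ^ 2) / 2 < 0 := by
  have hY := hC |r * q| (abs_nonneg _)
  have e1 : |r * q| ^ (2 * n) = (r * q) ^ (2 * n) := by
    rw [pow_mul, sq_abs, ← pow_mul]
  rw [e1, sq_abs] at hY
  have hP : 0 ≤ (r * q) ^ (2 * n) := by rw [pow_mul]; positivity
  set P := (r * q) ^ (2 * n) with hPdef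
  set D := 1 + a * q * c * (1 - P) with hDdef
  have hr0 : 0 < r := by linarith
  rw [sub_neg, div_lt_iff₀ hD]
  have hG : |1 - P| ≤ 1 + P := by
    rw [abs_le]; constructor <;> linarith
  have hc : |(1 - 2 * q ^ 2) * c| ≤ 1 := by
    rw [abs_mul]
    have h1 : |1 - 2 * q ^ 2| ≤ 1 := by
      rw [abs_le]; constructor <;> nlinarith [sq_nonneg q, sq_nonneg c]
    have h2 : |c| ≤ 1 := by
      rw [abs_le]; constructor <;> nlinarith [sq_nonneg q, sq_nonneg c]
    exact mul_le_one₀ h1 (abs_nonneg _) h2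
  have h3 : -((1 - 2 * q ^ 2) * c * ((r * q) * (1 - P))) ≤ |r * q| * (1 + P) := by
    calc _ ≤ |(1 - 2 * q ^ 2) * c * ((r * q) * (1 - P))| := neg_le_abs _
      _ = |(1 - 2 * q ^ 2) * c| * (|r * q| * |1 - P|) := by rw [abs_mul, abs_mul (r * q)]
      _ ≤ 1 * (|r * q| * (1 + P)) := by gcongr
      _ = _ := one_mul _
  have h4 : r * q ^ 2 ≤ (r * q) ^ 2 := by
    rw [mul_pow]; nlinarith [sq_nonneg q, mul_nonneg (mul_nonneg hr0.le (sub_nonneg.2 hr)) (sq_nonneg q)]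
  have hc2 : c ^ 2 - q ^ 2 = 1 - 2 * q ^ 2 := by linarith
  rw [hc2]
  have h5 : r * (r * (a * q ^ 2 * (1 - P))) - r * ((1 - 2 * q ^ 2) / 2 * D) < 0 := by
    rw [hDdef]
    have := mul_le_mul_of_nonneg_left h3 (by positivity : 0 ≤ a / 2)
    nlinarith
  nlinarith

theorem ray_N_alg (n a r q c P g D : ℝ) (hcs : q ^ 2 + c ^ 2 = 1)
    (hD : D = 1 + a * q * c * (1 - P)) (hg : g * D = a * q ^ 2 * (1 - P)) :
    (2 * r * (r * g) + a * (2 * r * (r * g) * q * c + r ^ 2 * (c ^ 2 - q ^ 2))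
      - a * ((-q * r + c * (r * g)) * P * r * q
        + c * r * (2 * n + 1) * P * ((r * g) * q + r * c))) * D
    = a * (1 - (2 * n + 1) * P) * (r ^ 2 * D) + 2 * n * a * P * (r * q) ^ 2 := by
  linear_combination (r ^ 2 * (2 + 2 * a * q * c - (2 * n + 2) * a * q * c * P)) * hg
    + a * r ^ 2 * (1 - (2 * n + 1) * P) * D * hcs
    + a * r ^ 2 * (-2 * q^2 + (2 * n + 2) * P * q^2) * hD

theorem ray_v_neg (n : ℕ) (hn : 0 < n) (a R : ℝ) (ha : 0 < a) (hR : 1 ≤ R) :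
    ∃ ε : ℝ, 0 < ε ∧ ε ≤ 1 ∧ ∀ r q c P D : ℝ, 1 ≤ r → r ≤ R → q ^ 2 + c ^ 2 = 1 →
      P = (r * q) ^ (2 * n) →  D = 1 + a * q * c * (1 - P) → r ^ 2 * D = ε →
      0 < a * (1 - (2 * n + 1) * P) * (r ^ 2 * D) + 2 * n * a * P * (r * q) ^ 2 := by
  set M : ℝ := a * (2 * n + 1) * R ^ (2 * n) with hM
  set η : ℝ := 1 / (2 * a * R * (1 + R ^ (2 * n))) with hη
  have hn' : (0:ℝ) < n := by exact_mod_cast hn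
  have hR0 : 0 < R := by linarith
  have hM0 : 0 < M := by positivity
  have hη0 : 0 < η := by positivity
  refine ⟨min (1 / 2) (n * a * η ^ (2 * n) * η ^ 2 / M), by positivity,
    (min_le_left _ _).trans (by norm_num), ?_⟩
  intro r q c P D hr hrR hqc hP hD hN
  set ε := min (1 / 2) (n * a * η ^ (2 * n) * η ^ 2 / M) with hε
  have hε0 : 0 < ε := by positivity
  have hε1 : ε ≤ 1 / 2 := min_le_left _ _
  have hε2 : M * ε ≤ n * a * η ^ (2 * n) * η ^ 2 := by
    have := min_le_right (1 / 2) (n * a * η ^ (2 * n) * η ^ 2 / M)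
    rw [← hε, le_div_iff₀ hM0] at this
    linarith
  rw [hN]
  have hr0 : 0 < r := by linarith
  have hq1 : |q| ≤ 1 := by
    rw [abs_le]; constructor <;> nlinarith [sq_nonneg q, sq_nonneg c]
  have hc1 : |c| ≤ 1 := by
    rw [abs_le]; constructor <;> nlinarith [sq_nonneg q, sq_nonneg c]
  have e1 : P = |r * q| ^ (2 * n) := by
    rw [hP, pow_mul |r * q|, sq_abs, ← pow_mul]
  have hz : |r * q| ≤ R := by
    rw [abs_mul, abs_of_pos hr0]; nlinarith [abs_nonneg q]
  have hP0 : 0 ≤ P := by rw [e1]; positivity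
  have hPR : P ≤ R ^ (2 * n) := by rw [e1]; gcongr
  have hlow : η ≤ |r * q| := by
    have h1 : 1 / 2 ≤ -(r ^ 2 * (a * q * c * (1 - P))) := by
      rw [hD] at hN; nlinarith
    have h2 : -(r ^ 2 * (a * q * c * (1 - P))) ≤ |r * q| * (a * R * (1 + R ^ (2 * n))) := by
      calc _ ≤ |r ^ 2 * (a * q * c * (1 - P))| := neg_le_abs _
        _ = |r * q| * (a * (r * |c|) * |1 - P|) := by
          simp only [abs_mul, abs_pow, abs_of_pos hr0, abs_of_pos ha]; ring
        _ ≤ |r * q| * (a * (R * 1) * (1 + R ^ (2 * n))) := by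
          gcongr
          rw [abs_le]; constructor <;> linarith
        _ = _ := by ring
    rw [hη, div_le_iff₀ (by positivity)]
    linarith
  have hPη : η ^ (2 * n) ≤ P := by rw [e1]; gcongr
  have hzη : η ^ 2 ≤ (r * q) ^ 2 := by rw [← sq_abs (r * q)]; gcongr
  have h6 : n * a * η ^ (2 * n) * η ^ 2 ≤ n * a * P * (r * q) ^ 2 := by gcongr
  have h7 : 0 < n * a * η ^ (2 * n) * η ^ 2 := by positivity
  have h8 : a * (2 * n + 1) * P * ε ≤ M * ε := by rw [hM]; gcongr
  have h9 : 0 < a * ε := by positivity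
  nlinarith

/-- The truncated polar field. -/
noncomputable def rayH (n : ℕ) (a δ φ r : ℝ) : ℝ :=
  r * (a * Real.sin φ ^ 2 * (1 - (r * Real.sin φ) ^ (2 * n))) /
    max (1 + a * Real.sin φ * Real.cos φ * (1 - (r * Real.sin φ) ^ (2 * n))) δ

noncomputable def rayF (n : ℕ) (a R δ φ r : ℝ) : ℝ :=
  rayH n a δ φ (max 1 (min r R))

theorem rayF_props (n : ℕ) (a R δ : ℝ) (ha : 0 < a) (hR : 1 ≤ R) (hδ : 0 < δ) :
    ∃ K L : ℝ≥0, (∀ t, LipschitzWith K (rayF n a R δ t)) ∧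
      (∀ x, Continuous (fun t => rayF n a R δ t x)) ∧ (∀ t x, |rayF n a R δ t x| ≤ L) := by
  have hR0 : 0 < R := by linarith
  -- bounds
  set B : ℝ := 1 + R ^ (2 * n) with hB
  set K1 : ℝ := (2 * n : ℕ) * R ^ (2 * n - 1) with hK1
  have hB0 : 0 < B := by positivity
  have hK10 : 0 ≤ K1 := by positivity
  have hq : ∀ t, |Real.sin t| ≤ 1 := Real.abs_sin_le_one
  have hc : ∀ t, |Real.cos t| ≤ 1 := Real.abs_cos_le_one
  have hz : ∀ t r, 1 ≤ r → r ≤ R → |r * Real.sin t| ≤ R := by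
    intro t r h1 h2
    rw [abs_mul, abs_of_pos (by linarith)]; nlinarith [hq t, abs_nonneg (Real.sin t)]
  have hG : ∀ t r, 1 ≤ r → r ≤ R → |1 - (r * Real.sin t) ^ (2 * n)| ≤ B := by
    intro t r h1 h2
    calc _ ≤ |(1:ℝ)| + |(r * Real.sin t) ^ (2 * n)| := abs_sub _ _
      _ ≤ _ := by
        rw [hB, abs_one, abs_pow]
        have := hz t r h1 h2
        gcongr
  have hGL : ∀ t r r', 1 ≤ r → r ≤ R → 1 ≤ r' → r' ≤ R →
      |(1 - (r * Real.sin t) ^ (2 * n)) - (1 - (r' * Real.sin t) ^ (2 * n))| ≤ K1 * |r - r'| := by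
    intro t r r' h1 h2 h1' h2'
    have := abs_pow_sub_pow_le (r' * Real.sin t) (r * Real.sin t) (2 * n)
    have e : r' * Real.sin t - r * Real.sin t = (r' - r) * Real.sin t := by ring
    have hm : max |r' * Real.sin t| |r * Real.sin t| ≤ R := max_le (hz _ _ h1' h2') (hz _ _ h1 h2)
    have e2 : (1 - (r * Real.sin t) ^ (2 * n)) - (1 - (r' * Real.sin t) ^ (2 * n)) =
      (r' * Real.sin t) ^ (2 * n) - (r * Real.sin t) ^ (2 * n) := by ring
    rw [e2]
    refine this.trans ?_
    rw [e, abs_mul, abs_sub_comm r' r]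
    calc _ ≤ |r - r'| * 1 * (2 * n : ℕ) * R ^ (2 * n - 1) := by
          gcongr
          exact hq t
      _ = _ := by rw [hK1]; ring
  -- numerator
  have hN : ∀ t r, 1 ≤ r → r ≤ R →
      |r * (a * Real.sin t ^ 2 * (1 - (r * Real.sin t) ^ (2 * n)))| ≤ R * (a * 1 * B) := by
    intro t r h1 h2
    rw [abs_mul, abs_mul, abs_mul, abs_of_pos ha, abs_of_pos (by linarith : 0 < r), abs_pow]
    have := hG t r h1 h2
    gcongr
    exact pow_le_one₀ (abs_nonneg _) (hq t)
  have hNL : ∀ t r r', 1 ≤ r → r ≤ R → 1 ≤ r' → r' ≤ R →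
      |r * (a * Real.sin t ^ 2 * (1 - (r * Real.sin t) ^ (2 * n))) -
        r' * (a * Real.sin t ^ 2 * (1 - (r' * Real.sin t) ^ (2 * n)))|
        ≤ (a * (B + R * K1)) * |r - r'| := by
    intro t r r' h1 h2 h1' h2'
    have e : r * (a * Real.sin t ^ 2 * (1 - (r * Real.sin t) ^ (2 * n))) -
        r' * (a * Real.sin t ^ 2 * (1 - (r' * Real.sin t) ^ (2 * n))) =
        (a * Real.sin t ^ 2) * ((r - r') * (1 - (r * Real.sin t) ^ (2 * n)) +
          r' * ((1 - (r * Real.sin t) ^ (2 * n)) - (1 - (r' * Real.sin t) ^ (2 * n)))) := by ring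
    rw [e, abs_mul, abs_mul, abs_of_pos ha, abs_pow]
    calc _ ≤ a * 1 * (|r - r'| * B + R * (K1 * |r - r'|)) := by
          have hs : |Real.sin t| ^ 2 ≤ 1 := pow_le_one₀ (abs_nonneg _) (hq t)
          gcongr
          refine (abs_add_le _ _).trans ?_
          rw [abs_mul, abs_mul, abs_of_pos (by linarith : 0 < r')]
          have := hG t r h1 h2
          have := hGL t r r' h1 h2 h1' h2'
          gcongr
      _ = _ := by ring
  have hDL : ∀ t r r', 1 ≤ r → r ≤ R → 1 ≤ r' → r' ≤ R →
      |max (1 + a * Real.sin t * Real.cos t * (1 - (r * Real.sin t) ^ (2 * n))) δ -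
       max (1 + a * Real.sin t * Real.cos t * (1 - (r' * Real.sin t) ^ (2 * n))) δ|
        ≤ (a * K1) * |r - r'| := by
    intro t r r' h1 h2 h1' h2'
    refine (abs_max_sub_max_le_abs _ _ _).trans ?_
    have e : (1 + a * Real.sin t * Real.cos t * (1 - (r * Real.sin t) ^ (2 * n))) -
      (1 + a * Real.sin t * Real.cos t * (1 - (r' * Real.sin t) ^ (2 * n))) =
      a * Real.sin t * Real.cos t * ((1 - (r * Real.sin t) ^ (2 * n)) -
        (1 - (r' * Real.sin t) ^ (2 * n))) := by ring
    rw [e, abs_mul, abs_mul, abs_mul, abs_of_pos ha]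
    have := hGL t r r' h1 h2 h1' h2'
    calc _ ≤ a * 1 * 1 * (K1 * |r - r'|) := by
          gcongr
          · exact hq t
          · exact hc t
      _ = _ := by ring
  have hclamp : ∀ r, 1 ≤ max 1 (min r R) ∧ max 1 (min r R) ≤ R := fun r =>
    ⟨le_max_left _ _, max_le hR (min_le_right _ _)⟩
  have hcl : ∀ r r', |max 1 (min r R) - max 1 (min r' R)| ≤ |r - r'| := by
    intro r r'
    have := ((LipschitzWith.id (α := ℝ)).min_const R).const_max 1
    simpa [Real.dist_eq] using this.dist_le_mul r r'
  set K : ℝ := (a * (B + R * K1)) / δ + (R * (a * 1 * B)) * (a * K1) / δ ^ 2 with hK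
  have hK0 : 0 ≤ K := by positivity
  have hHL : ∀ t r r', 1 ≤ r → r ≤ R → 1 ≤ r' → r' ≤ R →
      |rayH n a δ t r - rayH n a δ t r'| ≤ K * |r - r'| := by
    intro t r r' h1 h2 h1' h2'
    have i1 := hNL t r r' h1 h2 h1' h2'
    have i2 := hDL t r r' h1 h2 h1' h2'
    have i3 := hN t r' h1' h2'
    unfold rayH
    set N1 := r * (a * Real.sin t ^ 2 * (1 - (r * Real.sin t) ^ (2 * n)))
    set N2 := r' * (a * Real.sin t ^ 2 * (1 - (r' * Real.sin t) ^ (2 * n)))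
    have m1 := le_max_right (1 + a * Real.sin t * Real.cos t * (1 - (r * Real.sin t) ^ (2 * n))) δ
    have m2 := le_max_right (1 + a * Real.sin t * Real.cos t * (1 - (r' * Real.sin t) ^ (2 * n))) δ
    set M1 := max (1 + a * Real.sin t * Real.cos t * (1 - (r * Real.sin t) ^ (2 * n))) δ
    set M2 := max (1 + a * Real.sin t * Real.cos t * (1 - (r' * Real.sin t) ^ (2 * n))) δ
    have p1 : 0 < M1 := by linarith
    have p2 : 0 < M2 := by linarith
    have e : N1 / M1 - N2 / M2 = (N1 - N2) / M1 - N2 * (M1 - M2) / (M1 * M2) := by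
      field_simp; ring
    rw [e]
    refine (abs_sub _ _).trans ?_
    rw [abs_div, abs_div, abs_mul, abs_of_pos p1, abs_of_pos (mul_pos p1 p2)]
    calc _ ≤ ((a * (B + R * K1)) * |r - r'|) / δ +
          (R * (a * 1 * B)) * ((a * K1) * |r - r'|) / (δ * δ) := by gcongr
      _ = _ := by rw [hK]; field_simp
  refine ⟨⟨K, hK0⟩, ⟨R * (a * 1 * B) / δ, by positivity⟩, fun t => ?_, fun x => ?_, fun t x => ?_⟩
  · apply LipschitzWith.of_dist_le_mul
    intro r r'
    rw [Real.dist_eq, Real.dist_eq]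
    have := hHL t _ _ (hclamp r).1 (hclamp r).2 (hclamp r').1 (hclamp r').2
    refine this.trans ?_
    change _ ≤ K * _
    exact mul_le_mul_of_nonneg_left (hcl r r') hK0
  · unfold rayF rayH
    refine Continuous.div (by fun_prop) (by fun_prop) (fun t => ?_)
    exact ne_of_gt (lt_of_lt_of_le hδ (le_max_right _ _))
  · unfold rayF rayH
    rw [abs_div]
    have := hN t _ (hclamp x).1 (hclamp x).2
    change _ ≤ R * (a * 1 * B) / δ
    have m1 := le_max_right (1 + a * Real.sin t * Real.cos t *
      (1 - (max 1 (min x R) * Real.sin t) ^ (2 * n))) δ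
    rw [abs_of_pos (lt_of_lt_of_le hδ m1)]
    gcongr

theorem ray_hd {f g : ℝ → ℝ} {f' g' t : ℝ} (h : HasDerivAt f f' t) (hfg : ∀ s, g s = f s)
    (e : g' = f') : HasDerivAt g g' t := by
  have : g = f := funext hfg
  rw [this, e]; exact h

theorem ray_polar_exists (n : ℕ) (hn : 0 < n) (a : ℝ) (ha : 0 < a) :
    ∃ ρ : ℝ → ℝ, (∀ φ, 0 < ρ φ) ∧
      (∀ φ, 0 < 1 + a * Real.sin φ * Real.cos φ * (1 - (ρ φ * Real.sin φ) ^ (2 * n))) ∧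
      (∀ φ, HasDerivAt ρ (ρ φ * (a * Real.sin φ ^ 2 * (1 - (ρ φ * Real.sin φ) ^ (2 * n))) /
        (1 + a * Real.sin φ * Real.cos φ * (1 - (ρ φ * Real.sin φ) ^ (2 * n)))) φ) ∧
      (∀ φ, ρ (φ + Real.pi) = ρ φ) := by
  obtain ⟨C, hC0, hC⟩ := ray_poly_bound n hn a ha
  set k : ℝ := 2 * C + 1 with hk
  set R : ℝ := k + 1 with hRdef
  have hR : 1 ≤ R := by linarith
  obtain ⟨ε, hε0, hε1, hε⟩ := ray_v_neg n hn a R ha hR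
  set δ : ℝ := ε / R ^ 2 with hδdef
  have hδ : 0 < δ := by positivity
  obtain ⟨K, L, hK, hcont, hL⟩ := rayF_props n a R δ ha hR hδ
  choose α h0 hα using ray_global_ode (rayF n a R δ) K L hK hcont hL
  have hsc : ∀ φ, Real.sin φ ^ 2 + Real.cos φ ^ 2 = 1 := Real.sin_sq_add_cos_sq
  -- lower bound
  have hlow : ∀ x, 1 ≤ x → ∀ t, 0 ≤ t → 1 ≤ α x t := by
    intro x hx t ht
    by_contra hlt
    push Not at hlt
    -- use the function min(α - 1, 0)^2
    have hpos : ∀ φ r, r ≤ 1 → 0 ≤ rayF n a R δ φ r := by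
      intro φ r hr
      unfold rayF rayH
      have e : max 1 (min r R) = 1 := max_eq_left ((min_le_left _ _).trans hr)
      rw [e]
      apply div_nonneg
      · have : (1 * Real.sin φ) ^ (2 * n) ≤ 1 := by
          rw [one_mul, pow_mul]
          exact pow_le_one₀ (sq_nonneg _) (Real.sin_sq_le_one φ)
        have : 0 ≤ 1 - (1 * Real.sin φ) ^ (2 * n) := by linarith
        positivity
      · exact le_of_lt (lt_of_lt_of_le hδ (le_max_right _ _))
    have hB : ∀ e > 0, -(α x t) ≤ -1 + e * (t + 1) := by
      intro e he
      have := image_le_of_deriv_right_lt_deriv_boundary (f := fun s => -(α x s))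
        (f' := fun s => -(rayF n a R δ s (α x s))) (a := 0) (b := t)
        (B := fun s => -1 + e * (s + 1)) (B' := fun _ => e)
        (fun s _ => (hα x s).neg.continuousAt.continuousWithinAt)
        (fun s _ => (hα x s).neg.hasDerivWithinAt)
        (by simp only [h0]; linarith)
        (fun s => by
          have := (((hasDerivAt_id s).add_const (1:ℝ)).const_mul e).const_add (-1)
          simpa using this)
        (fun s hs h => by
          have : 0 ≤ rayF n a R δ s (α x s) := by
            apply hpos
            have : 0 ≤ e * (s + 1) := mul_nonneg he.le (by linarith [hs.1])
            linarith
          linarith)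
      exact this ⟨ht, le_rfl⟩
    have := hB ((1 - α x t) / (2 * (t + 1))) (by
      have : 0 < 1 - α x t := by linarith
      positivity)
    have e : (1 - α x t) / (2 * (t + 1)) * (t + 1) = (1 - α x t) / 2 := by
      have : t + 1 ≠ 0 := by positivity
      field_simp
    rw [e] at this
    linarith
  have hact : ∀ φ r, 1 ≤ r → r ≤ R →
      ε ≤ r ^ 2 * (1 + a * Real.sin φ * Real.cos φ * (1 - (r * Real.sin φ) ^ (2 * n))) →
      0 < 1 + a * Real.sin φ * Real.cos φ * (1 - (r * Real.sin φ) ^ (2 * n)) ∧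
      rayF n a R δ φ r = r * (a * Real.sin φ ^ 2 * (1 - (r * Real.sin φ) ^ (2 * n))) /
        (1 + a * Real.sin φ * Real.cos φ * (1 - (r * Real.sin φ) ^ (2 * n))) := by
    intro φ r h1 h2 h3
    have e : max 1 (min r R) = r := by rw [min_eq_left h2, max_eq_right h1]
    unfold rayF rayH
    rw [e]
    set D := 1 + a * Real.sin φ * Real.cos φ * (1 - (r * Real.sin φ) ^ (2 * n))
    have hD0 : 0 < D := by
      by_contra hneg
      push Not at hneg
      nlinarith [sq_nonneg r]
    have : δ ≤ D := by
      rw [hδdef, div_le_iff₀ (by positivity)]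
      have : r ^ 2 ≤ R ^ 2 := by gcongr
      nlinarith
    rw [max_eq_left this]
    exact ⟨hD0, rfl⟩
  have hqc : ∀ φ, |Real.sin φ * Real.cos φ| ≤ 1 := fun φ => by
    rw [abs_mul]
    exact mul_le_one₀ (Real.abs_sin_le_one _) (abs_nonneg _) (Real.abs_cos_le_one _)
  have hinv : ∀ x, 1 ≤ x → x ≤ k → ∀ t ∈ Icc 0 Real.pi,
      α x t - Real.sin t * Real.cos t / 2 ≤ k ∧
      -(α x t ^ 2 * (1 + a * Real.sin t * Real.cos t * (1 - (α x t * Real.sin t) ^ (2 * n)))) ≤ -ε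
      := by
    intro x hx1 hxk
    apply ray_barrier (fun t => α x t - Real.sin t * Real.cos t / 2)
      (fun t => -(α x t ^ 2 *
        (1 + a * Real.sin t * Real.cos t * (1 - (α x t * Real.sin t) ^ (2 * n)))))
      (fun t => rayF n a R δ t (α x t) - (Real.cos t ^ 2 - Real.sin t ^ 2) / 2)
      (fun t => -(2 * α x t * rayF n a R δ t (α x t) +
        a * (2 * α x t * rayF n a R δ t (α x t) * Real.sin t * Real.cos t +
          α x t ^ 2 * (Real.cos t ^ 2 - Real.sin t ^ 2))
        - a * ((-Real.sin t * α x t + Real.cos t * rayF n a R δ t (α x t)) *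
            (α x t * Real.sin t) ^ (2 * n) * α x t * Real.sin t
          + Real.cos t * α x t * (2 * n + 1) * (α x t * Real.sin t) ^ (2 * n) *
            (rayF n a R δ t (α x t) * Real.sin t + α x t * Real.cos t))))
    · intro t
      have := (hα x t).sub (((Real.hasDerivAt_sin t).mul (Real.hasDerivAt_cos t)).div_const 2)
      refine ray_hd this (fun _ => rfl) ?_
      ring
    · intro t
      have d1 := (hα x t).pow 2
      have d2 := (Real.hasDerivAt_sin t).mul (Real.hasDerivAt_cos t)
      have d3 := ((hα x t).mul (Real.hasDerivAt_sin t)).pow (2 * n + 1)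
      have d4 := ((Real.hasDerivAt_cos t).mul (hα x t))
      have := ((d1.add ((d1.mul d2).const_mul a)).sub ((d4.mul d3).const_mul a)).neg
      refine ray_hd this (fun s => ?_) ?_
      · simp only [Pi.mul_apply, Pi.pow_apply, Pi.add_apply, Pi.sub_apply, Pi.neg_apply]
        ring
      · simp only [Pi.mul_apply, Pi.pow_apply, Nat.add_sub_cancel]
        push_cast
        ring
    · simp [h0, hxk]
    · simp only [h0, Real.sin_zero]
      have : 1 ≤ x ^ 2 := one_le_pow₀ hx1
      simp
      linarith
    · intro t ht hu hv
      have hr1 := hlow x hx1 t ht.1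
      have hs := abs_le.1 (hqc t)
      have hrR : α x t ≤ R := by linarith
      obtain ⟨hD, hF⟩ := hact t (α x t) hr1 hrR (by linarith)
      rw [hF]
      exact ray_u_neg n a C _ _ _ ha hr1 (hsc t) hC (by linarith) hD
    · intro t ht hu hv
      have hr1 := hlow x hx1 t ht.1
      have hs := abs_le.1 (hqc t)
      have hrR : α x t ≤ R := by linarith
      obtain ⟨hD, hF⟩ := hact t (α x t) hr1 hrR (by linarith)
      have hpos := hε (α x t) _ _ _ _ hr1 hrR (hsc t) rfl rfl (by linarith)
      set D := 1 + a * Real.sin t * Real.cos t * (1 - (α x t * Real.sin t) ^ (2 * n)) with hDdef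
      have halg := ray_N_alg n a (α x t) _ _ _
        (a * Real.sin t ^ 2 * (1 - (α x t * Real.sin t) ^ (2 * n)) / D) D (hsc t) hDdef
        (by field_simp)
      have hF' : rayF n a R δ t (α x t) = α x t *
        (a * Real.sin t ^ 2 * (1 - (α x t * Real.sin t) ^ (2 * n)) / D) := by
        rw [hF]; ring
      rw [← hF'] at halg
      rw [← halg] at hpos
      have := pos_of_mul_pos_left hpos hD.le
      linarith
  -- fixed point
  have hΨ : Continuous (fun x => α x Real.pi) := by
    have : LipschitzWith (Real.toNNReal (Real.exp (K * Real.pi))) (fun x => α x Real.pi) := by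
      apply LipschitzWith.of_dist_le_mul
      intro x y
      have := dist_le_of_trajectories_ODE (v := rayF n a R δ) (K := K) (f := α x) (g := α y)
        (a := 0) (b := Real.pi) (δ := dist x y) hK
        (fun s _ => (hα x s).continuousAt.continuousWithinAt)
        (fun s _ => (hα x s).hasDerivWithinAt)
        (fun s _ => (hα y s).continuousAt.continuousWithinAt)
        (fun s _ => (hα y s).hasDerivWithinAt)
        (by rw [h0, h0]) Real.pi ⟨Real.pi_pos.le, le_rfl⟩
      rw [Real.coe_toNNReal _ (Real.exp_pos _).le]
      simpa [mul_comm] using this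
    exact this.continuous
  have hk1 : 1 ≤ k := by linarith
  obtain ⟨x, hx, hfix⟩ : ∃ x ∈ Icc 1 k, α x Real.pi = x := by
    have hc : ContinuousOn (fun x => α x Real.pi - x) (Icc 1 k) :=
      (hΨ.sub continuous_id).continuousOn
    have h1 : 0 ≤ α 1 Real.pi - 1 := by linarith [hlow 1 le_rfl Real.pi Real.pi_pos.le]
    have h2 : α k Real.pi - k ≤ 0 := by
      have := (hinv k hk1 le_rfl Real.pi ⟨Real.pi_pos.le, le_rfl⟩).1
      simp at this
      linarith
    obtain ⟨x, hx, hx'⟩ := intermediate_value_Icc' hk1 hc ⟨h2, h1⟩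
    exact ⟨x, hx, by linarith⟩
  have hper : ∀ φ, α x (φ + Real.pi) = α x φ := by
    have := ODE_solution_unique_univ (v := rayF n a R δ) (K := K) (s := fun _ => univ)
      (f := fun φ => α x (φ + Real.pi)) (g := α x) (t₀ := 0)
      (fun t => (hK t).lipschitzOnWith)
      (fun t => ⟨by
        have h := (hα x (t + Real.pi)).comp_add_const t Real.pi
        convert h using 1
        unfold rayF rayH
        simp only [Real.sin_add_pi, Real.cos_add_pi, mul_neg, neg_mul, neg_neg, neg_sq,
          Even.neg_pow (even_two_mul n)], trivial⟩)
      (fun t => ⟨hα x t, trivial⟩)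
      (by simp [hfix, h0])
    exact fun φ => congrFun this φ
  have hgood : ∀ φ, 1 ≤ α x φ ∧ α x φ ≤ R ∧
      ε ≤ α x φ ^ 2 * (1 + a * Real.sin φ * Real.cos φ * (1 - (α x φ * Real.sin φ) ^ (2 * n))) := by
    have hP : Function.Periodic (fun φ => (α x φ, a * Real.sin φ * Real.cos φ,
        (α x φ * Real.sin φ) ^ (2 * n))) Real.pi := by
      intro φ
      simp only [hper, Real.sin_add_pi, Real.cos_add_pi, mul_neg, neg_mul, neg_neg,
          Even.neg_pow (even_two_mul n)]
    intro φ
    obtain ⟨y, hy, hyφ⟩ := hP.exists_mem_Ico₀ Real.pi_pos φ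
    simp only [Prod.mk.injEq] at hyφ
    obtain ⟨e1, e2, e3⟩ := hyφ
    rw [e3, e2, e1]
    have hi := hinv x hx.1 hx.2 y ⟨hy.1, hy.2.le⟩
    have hs := abs_le.1 (hqc y)
    exact ⟨hlow x hx.1 y hy.1, by linarith [hi.1], by linarith [hi.2]⟩
  refine ⟨α x, fun φ => by linarith [(hgood φ).1], fun φ => ?_, fun φ => ?_, hper⟩
  · exact (hact φ _ (hgood φ).1 (hgood φ).2.1 (hgood φ).2.2).1
  · rw [← (hact φ _ (hgood φ).1 (hgood φ).2.1 (hgood φ).2.2).2]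
    exact hα x φ


theorem ray_surj (f : ℝ → ℝ) (hf : Continuous f) (p T : ℝ) (hT : 0 < T)
    (h : ∀ x, f (x + p) = f x + T) : Function.Surjective f := by
  have key : ∀ (m : ℕ) (x : ℝ), f (x + m * p) = f x + m * T := by
    intro m
    induction m with
    | zero => intro x; simp
    | succ m ih =>
      intro x
      have : x + ((m + 1 : ℕ) : ℝ) * p = (x + m * p) + p := by push_cast; ring
      rw [this, h, ih]; push_cast; ring
  intro c
  obtain ⟨m, hm⟩ := exists_nat_ge (|c - f 0| / T)
  rw [div_le_iff₀ hT] at hm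
  have hm' := abs_le.1 hm
  apply mem_range_of_exists_le_of_exists_ge hf
  · refine ⟨-(m * p), ?_⟩
    have := key m (-(m * p))
    rw [neg_add_cancel] at this
    linarith [hm'.1]
  · refine ⟨0 + m * p, ?_⟩
    rw [key]
    linarith [hm'.2]

theorem ray_orbit_of_polar (n : ℕ) (a : ℝ) (ρ : ℝ → ℝ) (hρ : ∀ φ, 0 < ρ φ)
    (hD : ∀ φ, 0 < 1 + a * Real.sin φ * Real.cos φ * (1 - (ρ φ * Real.sin φ) ^ (2 * n)))
    (hd : ∀ φ, HasDerivAt ρ (ρ φ * (a * Real.sin φ ^ 2 * (1 - (ρ φ * Real.sin φ) ^ (2 * n))) /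
        (1 + a * Real.sin φ * Real.cos φ * (1 - (ρ φ * Real.sin φ) ^ (2 * n)))) φ)
    (hper : ∀ φ, ρ (φ + Real.pi) = ρ φ) :
    IsPeriodicOrbitRayleigh n a
      (range (fun φ : ℝ => (ρ φ * Real.cos φ, -(ρ φ * Real.sin φ)))) := by
  have hρc : Continuous ρ := continuous_iff_continuousAt.2 fun t => (hd t).continuousAt
  have hper2 : ∀ φ, ρ (φ + 2 * Real.pi) = ρ φ := by
    intro φ
    have : φ + 2 * Real.pi = φ + Real.pi + Real.pi := by ring
    rw [this, hper, hper]
  set g : ℝ → ℝ := fun φ =>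
    1 + a * Real.sin φ * Real.cos φ * (1 - (ρ φ * Real.sin φ) ^ (2 * n)) with hg
  have hgc : Continuous g := by fun_prop
  have hgi : Continuous (fun φ => (g φ)⁻¹) := hgc.inv₀ fun φ => (hD φ).ne'
  set τ : ℝ → ℝ := fun φ => ∫ s in (0:ℝ)..φ, (g s)⁻¹ with hτ
  have hτd : ∀ φ, HasDerivAt τ (g φ)⁻¹ φ := fun φ =>
    intervalIntegral.integral_hasDerivAt_right (hgi.intervalIntegrable _ _)
      hgi.aestronglyMeasurable.stronglyMeasurableAtFilter hgi.continuousAt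
  have hτc : Continuous τ := continuous_iff_continuousAt.2 fun t => (hτd t).continuousAt
  have hmono : StrictMono τ := strictMono_of_deriv_pos fun φ => by
    rw [(hτd φ).deriv]; exact inv_pos.2 (hD φ)
  have hgper : ∀ φ, g (φ + 2 * Real.pi) = g φ := by
    intro φ
    simp only [hg, Real.sin_add_two_pi, Real.cos_add_two_pi, hper2]
  set T := τ (2 * Real.pi) with hT
  have hτ0 : τ 0 = 0 := by simp [hτ]
  have hT0 : 0 < T := by rw [← hτ0]; exact hmono (by positivity)
  have hshift : ∀ φ, τ (φ + 2 * Real.pi) = τ φ + T := by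
    have hc : ∀ φ, HasDerivAt (fun φ => τ (φ + 2 * Real.pi) - τ φ) 0 φ := by
      intro φ
      have := ((hτd (φ + 2 * Real.pi)).comp_add_const φ (2 * Real.pi)).sub (hτd φ)
      refine ray_hd this (fun _ => rfl) ?_
      rw [hgper]; ring
    intro φ
    have := is_const_of_deriv_eq_zero (fun s => (hc s).differentiableAt)
      (fun s => (hc s).deriv) φ 0
    simp only [zero_add, hτ0] at this
    linarith
  have hsurj := ray_surj τ hτc _ T hT0 hshift
  let e := hmono.orderIsoOfSurjective τ hsurj
  set Φ : ℝ → ℝ := fun t => e.symm t with hΦ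
  have hΦc : Continuous Φ := e.symm.continuous
  have hτΦ : ∀ t, τ (Φ t) = t := fun t => e.apply_symm_apply t
  have hΦτ : ∀ φ, Φ (τ φ) = φ := fun φ => e.symm_apply_apply φ
  have hΦd : ∀ t, HasDerivAt Φ (g (Φ t)) t := by
    intro t
    have := HasDerivAt.of_local_left_inverse hΦc.continuousAt (hτd (Φ t))
      (inv_ne_zero (hD (Φ t)).ne') (Eventually.of_forall hτΦ)
    rwa [inv_inv] at this
  have hΦT : ∀ t, Φ (t + T) = Φ t + 2 * Real.pi := by
    intro t
    apply hmono.injective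
    rw [hτΦ, hshift, hτΦ]
  refine ⟨fun t => ρ (Φ t) * Real.cos (Φ t), fun t => -(ρ (Φ t) * Real.sin (Φ t)),
    ⟨fun t => ⟨?_, ?_⟩, ?_, T, hT0, ?_⟩, ?_⟩
  · have h1 := ((hd (Φ t)).mul (Real.hasDerivAt_cos (Φ t))).comp t (hΦd t)
    refine ray_hd h1 (fun _ => rfl) ?_
    have hne := (hD (Φ t)).ne'
    have hR : g (Φ t) = 1 + a * Real.sin (Φ t) * Real.cos (Φ t) *
      (1 - (ρ (Φ t) * Real.sin (Φ t)) ^ (2 * n)) := rfl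
    rw [hR, add_mul, div_mul_eq_mul_div, div_mul_cancel₀ _ hne]
    ring
  · have h1 := ((hd (Φ t)).mul (Real.hasDerivAt_sin (Φ t))).neg.comp t (hΦd t)
    refine ray_hd h1 (fun _ => rfl) ?_
    have hne := (hD (Φ t)).ne'
    have hs := Real.sin_sq_add_cos_sq (Φ t)
    rw [Even.neg_pow (even_two_mul n)]
    simp only [hg]
    set P := (ρ (Φ t) * Real.sin (Φ t)) ^ (2 * n)
    set q := Real.sin (Φ t)
    set c := Real.cos (Φ t)
    have : (-(ρ (Φ t) * (a * q ^ 2 * (1 - P)) / (1 + a * q * c * (1 - P)) * q + ρ (Φ t) * c)) *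
      (1 + a * q * c * (1 - P)) =
      -(ρ (Φ t) * (a * q ^ 2 * (1 - P)) * q + ρ (Φ t) * c * (1 + a * q * c * (1 - P))) := by
      rw [neg_mul, add_mul, div_mul_eq_mul_div, div_mul_cancel₀ _ hne]
    rw [this]
    linear_combination (a * ρ (Φ t) * q * (1 - P)) * hs
  · refine ⟨τ 0, τ Real.pi, ?_⟩
    simp only [hΦτ]
    have h1 := hρ 0
    have h2 := hρ Real.pi
    intro h
    have := (Prod.mk.inj h).1
    simp at this
    linarith
  · intro t
    simp only [hΦT, hper2, Real.sin_add_two_pi, Real.cos_add_two_pi]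
  · ext p
    constructor
    · rintro ⟨φ, rfl⟩
      exact ⟨τ φ, by simp only [hΦτ]⟩
    · rintro ⟨t, rfl⟩
      exact ⟨Φ t, rfl⟩

theorem ray_energy_pos (n : ℕ) (a : ℝ) (ha : 0 < a) (x y : ℝ → ℝ)
    (h : IsPeriodicSolRayleigh n a x y) : ∀ t, 0 < x t ^ 2 + y t ^ 2 := by
  obtain ⟨hs, ⟨t₁, t₂, hne⟩, T, hT, hper⟩ := h
  by_contra hcon
  push Not at hcon
  obtain ⟨t0, ht0⟩ := hcon
  have hd : ∀ t, HasDerivAt (fun t => (x t ^ 2 + y t ^ 2) * Real.exp (-(2 * a * t)))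
      (-(2 * a) * (x t ^ 2 + y t ^ 2 * (y t ^ (2 * n))) * Real.exp (-(2 * a * t))) t := by
    intro t
    have := ((((hs t).1.pow 2).add ((hs t).2.pow 2)).mul
      (((hasDerivAt_id t).const_mul (2 * a)).neg.exp))
    refine ray_hd this (fun _ => rfl) ?_
    simp only [id, Pi.neg_apply, Pi.add_apply, Pi.pow_apply]
    push_cast
    ring
  have hanti : Antitone (fun t => (x t ^ 2 + y t ^ 2) * Real.exp (-(2 * a * t))) := by
    apply antitone_of_deriv_nonpos (fun t => (hd t).differentiableAt)
    intro t
    rw [(hd t).deriv]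
    have : 0 ≤ (x t ^ 2 + y t ^ 2 * (y t ^ (2 * n))) * Real.exp (-(2 * a * t)) := by
      rw [pow_mul]; positivity
    nlinarith
  have hz : ∀ t, t0 ≤ t → x t = 0 ∧ y t = 0 := by
    intro t ht
    have h1 := hanti ht
    simp only at h1
    have h2 : x t ^ 2 + y t ^ 2 ≤ 0 := by
      by_contra hc
      push Not at hc
      have := mul_pos hc (Real.exp_pos (-(2 * a * t)))
      have := mul_nonneg (neg_nonneg.2 ht0) (Real.exp_pos (-(2 * a * t0))).le
      linarith
    constructor <;> nlinarith [sq_nonneg (x t), sq_nonneg (y t)]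
  have hall : ∀ t, x t = 0 ∧ y t = 0 := by
    have hP : Function.Periodic (fun t => (x t, y t)) T := hper
    intro t
    obtain ⟨s, hs, hst⟩ := hP.exists_mem_Ico hT t t0
    have := hz s hs.1
    simp only [Prod.mk.injEq] at hst
    rw [hst.1, hst.2]; exact this
  apply hne
  rw [(hall t₁).1, (hall t₁).2, (hall t₂).1, (hall t₂).2]

theorem ray_N_pos (n : ℕ) (a : ℝ) (ha : 0 < a) (x y : ℝ → ℝ)
    (h : IsPeriodicSolRayleigh n a x y) :
    ∀ t, 0 < x t ^ 2 + y t ^ 2 - a * (x t * y t * (1 - y t ^ (2 * n))) := by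
  have hE := ray_energy_pos n a ha x y h
  obtain ⟨hs, -, T, hT, hper⟩ := h
  have hxc : Continuous x := continuous_iff_continuousAt.2 fun t => (hs t).1.continuousAt
  have hyc : Continuous y := continuous_iff_continuousAt.2 fun t => (hs t).2.continuousAt
  have hP : Function.Periodic (fun t => (x t, y t)) T := hper
  obtain ⟨t0, -, ht0⟩ : ∃ t0 ∈ Ioo 0 T, y t0 = 0 := by
    apply exists_hasDerivAt_eq_zero hT hxc.continuousOn
    · have := (Prod.mk.inj (hper 0)).1
      rw [zero_add] at this; exact this.symm
    · intro t _; exact (hs t).1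
  set κ : ℝ → ℝ := fun t => a * (1 - (2 * n + 1) * y t ^ (2 * n)) with hκ
  have hκc : Continuous κ := by fun_prop
  set A : ℝ → ℝ := fun t => ∫ s in (0:ℝ)..t, κ s with hA
  have hAd : ∀ t, HasDerivAt A (κ t) t := fun t =>
    intervalIntegral.integral_hasDerivAt_right (hκc.intervalIntegrable _ _)
      hκc.aestronglyMeasurable.stronglyMeasurableAtFilter hκc.continuousAt
  set N : ℝ → ℝ := fun t => x t ^ 2 + y t ^ 2 - a * (x t * y t * (1 - y t ^ (2 * n))) with hN
  have hNd : ∀ t, HasDerivAt N (κ t * N t + 2 * n * a * (y t ^ 2 * y t ^ (2 * n))) t := by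
    intro t
    have d1 := ((hs t).1.pow 2).add ((hs t).2.pow 2)
    have d2 := ((hs t).1.mul (hs t).2).const_mul a
    have d3 := ((hs t).1.mul ((hs t).2.pow (2 * n + 1))).const_mul a
    refine ray_hd ((d1.sub d2).add d3) (fun s => ?_) ?_
    · simp only [hN, Pi.mul_apply, Pi.pow_apply, Pi.add_apply, Pi.sub_apply]
      ring
    · simp only [hN, hκ, Pi.mul_apply, Pi.pow_apply, Nat.add_sub_cancel]
      push_cast
      ring
  have hMd : ∀ t, HasDerivAt (fun t => N t * Real.exp (-A t))
      (2 * n * a * (y t ^ 2 * y t ^ (2 * n)) * Real.exp (-A t)) t := by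
    intro t
    refine ray_hd ((hNd t).mul (hAd t).neg.exp) (fun _ => rfl) ?_
    simp only [Pi.neg_apply]
    ring
  have hmono : Monotone (fun t => N t * Real.exp (-A t)) := by
    apply monotone_of_deriv_nonneg (fun t => (hMd t).differentiableAt)
    intro t
    rw [(hMd t).deriv, pow_mul]
    positivity
  have hN0 : 0 < N t0 := by
    have := hE t0
    simp only [hN, ht0] at this ⊢
    simpa using this
  have hpos : ∀ t, t0 ≤ t → 0 < N t := by
    intro t ht
    have h1 := hmono ht
    simp only at h1
    have h2 := mul_pos hN0 (Real.exp_pos (-A t0))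
    exact pos_of_mul_pos_left (lt_of_lt_of_le h2 h1) (Real.exp_pos _).le
  intro t
  obtain ⟨s, hs, hst⟩ := hP.exists_mem_Ico hT t t0
  have := hpos s hs.1
  simp only [Prod.mk.injEq] at hst
  rw [hst.1, hst.2]; exact this

theorem ray_const_mul {v κ r : ℝ → ℝ} (hr : ∀ t, 0 < r t)
    (hrd : ∀ t, HasDerivAt r (κ t * r t) t) (hv : ∀ t, HasDerivAt v (κ t * v t) t) :
    ∀ t, v t = v 0 / r 0 * r t := by
  have hc : ∀ t, HasDerivAt (fun t => v t / r t) 0 t := by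
    intro t
    refine ray_hd ((hv t).div (hrd t) (hr t).ne') (fun _ => rfl) ?_
    have := (hr t).ne'
    field_simp
    ring
  intro t
  have := is_const_of_deriv_eq_zero (fun s => (hc s).differentiableAt)
    (fun s => (hc s).deriv) t 0
  rw [← this, div_mul_cancel₀ _ (hr t).ne']

theorem ray_polar_coords (n : ℕ) (a : ℝ) (ha : 0 < a) (x y : ℝ → ℝ)
    (h : IsPeriodicSolRayleigh n a x y) :
    ∃ r φ : ℝ → ℝ, (∀ t, 0 < r t) ∧ (∀ t, x t = r t * Real.cos (φ t)) ∧
      (∀ t, y t = -(r t * Real.sin (φ t))) ∧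
      (∀ t, HasDerivAt r (a * Real.sin (φ t) ^ 2 * (1 - (r t * Real.sin (φ t)) ^ (2 * n)) * r t) t) ∧
      (∀ t, HasDerivAt φ
        (1 + a * Real.sin (φ t) * Real.cos (φ t) * (1 - (r t * Real.sin (φ t)) ^ (2 * n))) t) ∧
      (∀ t, 0 < 1 + a * Real.sin (φ t) * Real.cos (φ t) *
        (1 - (r t * Real.sin (φ t)) ^ (2 * n))) ∧
      (∀ t, r t = √(x t ^ 2 + y t ^ 2)) := by
  have hE := ray_energy_pos n a ha x y h
  have hN := ray_N_pos n a ha x y h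
  obtain ⟨hs, -, T, hT, hper⟩ := h
  have hxc : Continuous x := continuous_iff_continuousAt.2 fun t => (hs t).1.continuousAt
  have hyc : Continuous y := continuous_iff_continuousAt.2 fun t => (hs t).2.continuousAt
  set r : ℝ → ℝ := fun t => √(x t ^ 2 + y t ^ 2) with hr
  have hrpos : ∀ t, 0 < r t := fun t => Real.sqrt_pos.2 (hE t)
  have hr2 : ∀ t, r t ^ 2 = x t ^ 2 + y t ^ 2 := fun t => Real.sq_sqrt (hE t).le
  set ω : ℝ → ℝ := fun t => (x t ^ 2 + y t ^ 2 - a * (x t * y t * (1 - y t ^ (2 * n)))) /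
    (x t ^ 2 + y t ^ 2) with hω
  have hωc : Continuous ω := by
    apply Continuous.div
    · fun_prop
    · fun_prop
    · exact fun t => (hE t).ne'
  set z : ℂ := ⟨x 0, -y 0⟩ with hz
  set φ : ℝ → ℝ := fun t => z.arg + ∫ s in (0:ℝ)..t, ω s with hφ
  have hφd : ∀ t, HasDerivAt φ (ω t) t := fun t =>
    (intervalIntegral.integral_hasDerivAt_right (hωc.intervalIntegrable _ _)
      hωc.aestronglyMeasurable.stronglyMeasurableAtFilter hωc.continuousAt).const_add _
  have hφ0 : φ 0 = z.arg := by simp [hφ]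
  have hnz : ‖z‖ = r 0 := by
    rw [Complex.norm_def, Complex.normSq_apply]
    simp only [hr, hz]
    congr 1; ring
  have hx0 : x 0 = r 0 * Real.cos (φ 0) := by
    rw [hφ0, ← hnz, Complex.norm_mul_cos_arg]
  have hy0 : y 0 = -(r 0 * Real.sin (φ 0)) := by
    rw [hφ0, ← hnz, Complex.norm_mul_sin_arg]; simp [hz]
  set κ : ℝ → ℝ := fun t => a * (1 - y t ^ (2 * n)) * y t ^ 2 / (x t ^ 2 + y t ^ 2) with hκ
  have hrd : ∀ t, HasDerivAt r (κ t * r t) t := by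
    intro t
    refine ray_hd ((((hs t).1.pow 2).add ((hs t).2.pow 2)).sqrt (hE t).ne') (fun _ => rfl) ?_
    have h1 := (hrpos t).ne'
    change _ = _ / (2 * r t)
    simp only [hκ]
    rw [← hr2]
    field_simp
    push_cast
    ring
  have hv : ∀ t, HasDerivAt (fun t => x t * Real.sin (φ t) + y t * Real.cos (φ t))
      (κ t * (x t * Real.sin (φ t) + y t * Real.cos (φ t))) t := by
    intro t
    refine ray_hd (((hs t).1.mul (hφd t).sin).add ((hs t).2.mul (hφd t).cos)) (fun _ => rfl) ?_
    have h1 := (hE t).ne'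
    simp only [hκ, hω]
    field_simp
    ring
  have hw : ∀ t, HasDerivAt (fun t => x t * Real.cos (φ t) - y t * Real.sin (φ t))
      (κ t * (x t * Real.cos (φ t) - y t * Real.sin (φ t))) t := by
    intro t
    refine ray_hd (((hs t).1.mul (hφd t).cos).sub ((hs t).2.mul (hφd t).sin)) (fun _ => rfl) ?_
    have h1 := (hE t).ne'
    simp only [hκ, hω]
    field_simp
    ring
  have hV : ∀ t, x t * Real.sin (φ t) + y t * Real.cos (φ t) = 0 := by
    intro t
    have := ray_const_mul hrpos hrd hv t
    rw [this, hx0, hy0]; ring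
  have hW : ∀ t, x t * Real.cos (φ t) - y t * Real.sin (φ t) = r t := by
    intro t
    have := ray_const_mul hrpos hrd hw t
    have h1 : x 0 * Real.cos (φ 0) - y 0 * Real.sin (φ 0) = r 0 := by
      rw [hx0, hy0]
      linear_combination r 0 * Real.sin_sq_add_cos_sq (φ 0)
    rw [this, h1, div_self (hrpos 0).ne', one_mul]
  have hX : ∀ t, x t = r t * Real.cos (φ t) := by
    intro t
    have := Real.sin_sq_add_cos_sq (φ t)
    linear_combination Real.sin (φ t) * hV t + Real.cos (φ t) * hW t - x t * this
  have hY : ∀ t, y t = -(r t * Real.sin (φ t)) := by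
    intro t
    have := Real.sin_sq_add_cos_sq (φ t)
    linear_combination Real.cos (φ t) * hV t - Real.sin (φ t) * hW t - y t * this
  have hYp : ∀ t, y t ^ (2 * n) = (r t * Real.sin (φ t)) ^ (2 * n) := by
    intro t
    rw [hY t, Even.neg_pow (even_two_mul n)]
  have hωe : ∀ t, ω t =
      1 + a * Real.sin (φ t) * Real.cos (φ t) * (1 - (r t * Real.sin (φ t)) ^ (2 * n)) := by
    intro t
    have h1 := (hrpos t).ne'
    simp only [hω]
    rw [hYp t, ← hr2 t]
    generalize (r t * Real.sin (φ t)) ^ (2 * n) = P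
    rw [hX t, hY t]
    field_simp
    ring
  have hκe : ∀ t, κ t =
      a * Real.sin (φ t) ^ 2 * (1 - (r t * Real.sin (φ t)) ^ (2 * n)) := by
    intro t
    have h1 := (hrpos t).ne'
    simp only [hκ]
    rw [hYp t, ← hr2 t]
    generalize (r t * Real.sin (φ t)) ^ (2 * n) = P
    rw [hY t]
    field_simp
  refine ⟨r, φ, hrpos, hX, hY, ?_, ?_, ?_, fun t => rfl⟩
  · intro t
    rw [← hκe]; exact hrd t
  · intro t
    rw [← hωe]; exact hφd t
  · intro t
    rw [← hωe]; exact div_pos (hN t) (hE t)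

theorem ray_orbit_eq (n : ℕ) (hn : 0 < n) (a : ℝ) (ha : 0 < a) (ρ : ℝ → ℝ) (hρ : ∀ φ, 0 < ρ φ)
    (hD : ∀ φ, 0 < 1 + a * Real.sin φ * Real.cos φ * (1 - (ρ φ * Real.sin φ) ^ (2 * n)))
    (hd : ∀ φ, HasDerivAt ρ (ρ φ * (a * Real.sin φ ^ 2 * (1 - (ρ φ * Real.sin φ) ^ (2 * n))) /
        (1 + a * Real.sin φ * Real.cos φ * (1 - (ρ φ * Real.sin φ) ^ (2 * n)))) φ)
    (hper : ∀ φ, ρ (φ + Real.pi) = ρ φ) (x y : ℝ → ℝ) (h : IsPeriodicSolRayleigh n a x y) :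
    range (fun t : ℝ => (x t, y t)) =
      (range (fun φ : ℝ => (ρ φ * Real.cos φ, -(ρ φ * Real.sin φ)))) := by
  have hE := ray_energy_pos n a ha x y h
  obtain ⟨r, φ, hr, hx, hy, hrd, hφd, hφp, hrE⟩ := ray_polar_coords n a ha x y h
  obtain ⟨hs, -, T, hT, hperT⟩ := h
  have hxT : ∀ t, x (t + T) = x t := fun t => (Prod.mk.inj (hperT t)).1
  have hyT : ∀ t, y (t + T) = y t := fun t => (Prod.mk.inj (hperT t)).2
  have hrT : ∀ t, r (t + T) = r t := by
    intro t; rw [hrE, hrE, hxT, hyT]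
  have hcT : ∀ t, Real.cos (φ (t + T)) = Real.cos (φ t) := by
    intro t
    have := hxT t
    rw [hx, hx, hrT] at this
    exact mul_left_cancel₀ (hr t).ne' this
  have hsT : ∀ t, Real.sin (φ (t + T)) = Real.sin (φ t) := by
    intro t
    have := hyT t
    rw [hy, hy, hrT] at this
    exact mul_left_cancel₀ (hr t).ne' (neg_injective this)
  have hper2 : Function.Periodic ρ (2 * Real.pi) := by
    intro φ
    have : φ + 2 * Real.pi = φ + Real.pi + Real.pi := by ring
    rw [this, hper, hper]
  have hρT : ∀ t, ρ (φ (t + T)) = ρ (φ t) := by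
    intro t
    have h1 : ((φ (t + T) : ℝ) : Real.Angle) = (φ t : ℝ) :=
      Real.Angle.cos_sin_inj (hcT t) (hsT t)
    obtain ⟨k, hk⟩ := Real.Angle.angle_eq_iff_two_pi_dvd_sub.1 h1
    have : φ (t + T) = φ t + k * (2 * Real.pi) := by linarith
    rw [this]
    exact hper2.int_mul k (φ t)
  have hφc : Continuous φ := continuous_iff_continuousAt.2 fun t => (hφd t).continuousAt
  have hφm : StrictMono φ := strictMono_of_deriv_pos fun t => by
    rw [(hφd t).deriv]; exact hφp t
  have hshift : ∀ t, φ (t + T) = φ t + (φ T - φ 0) := by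
    have hc : ∀ t, HasDerivAt (fun t => φ (t + T) - φ t) 0 t := by
      intro t
      refine ray_hd (((hφd (t + T)).comp_add_const t T).sub (hφd t)) (fun _ => rfl) ?_
      rw [hrT, hsT, hcT]; ring
    intro t
    have := is_const_of_deriv_eq_zero (fun s => (hc s).differentiableAt)
      (fun s => (hc s).deriv) t 0
    simp only [zero_add] at this
    linarith
  have hsurj := ray_surj φ hφc T _ (sub_pos.2 (hφm hT)) hshift
  set S : ℝ → ℝ := fun t => (r t / ρ (φ t) - 1) ^ 2 with hS
  set S' : ℝ → ℝ := fun t => 2 * (r t / ρ (φ t) - 1) * ((r t / ρ (φ t)) * (a * Real.sin (φ t) ^ 2 *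
      ((ρ (φ t) * Real.sin (φ t)) ^ (2 * n) - (r t * Real.sin (φ t)) ^ (2 * n))) /
      (1 + a * Real.sin (φ t) * Real.cos (φ t) *
        (1 - (ρ (φ t) * Real.sin (φ t)) ^ (2 * n)))) with hS'
  have hSd : ∀ t, HasDerivAt S (S' t) t := by
    intro t
    have h1 := (hd (φ t)).comp t (hφd t)
    have h2 := (((hrd t).div h1 (hρ (φ t)).ne').sub_const 1).pow 2
    refine ray_hd h2 (fun _ => rfl) ?_
    have hne := (hD (φ t)).ne'
    have hne2 := (hρ (φ t)).ne'
    simp only [hS', Function.comp_apply, Pi.div_apply]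
    generalize (ρ (φ t) * Real.sin (φ t)) ^ (2 * n) = P at *
    generalize (r t * Real.sin (φ t)) ^ (2 * n) = Q at *
    generalize Real.sin (φ t) = q at *
    generalize Real.cos (φ t) = c at *
    generalize hDD : 1 + a * q * c * (1 - P) = DD at *
    push_cast
    field_simp
    rw [← hDD]
    ring
  have hsplit : ∀ t, (r t / ρ (φ t) - 1) * (ρ (φ t) ^ (2 * n) - r t ^ (2 * n)) ≤ 0 ∧
      (r t ≠ ρ (φ t) → (r t / ρ (φ t) - 1) * (ρ (φ t) ^ (2 * n) - r t ^ (2 * n)) < 0) := by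
    intro t
    have hn2 : 2 * n ≠ 0 := by omega
    rcases lt_trichotomy (r t) (ρ (φ t)) with hlt | heq | hgt
    · have h1 : r t / ρ (φ t) < 1 := (div_lt_one (hρ _)).2 hlt
      have h2 := pow_lt_pow_left₀ hlt (hr t).le hn2
      have : (r t / ρ (φ t) - 1) * (ρ (φ t) ^ (2 * n) - r t ^ (2 * n)) < 0 :=
        mul_neg_of_neg_of_pos (by linarith) (by linarith)
      exact ⟨this.le, fun _ => this⟩
    · rw [heq]; simp
    · have h1 : 1 < r t / ρ (φ t) := (one_lt_div (hρ _)).2 hgt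
      have h2 := pow_lt_pow_left₀ hgt (hρ (φ t)).le hn2
      have : (r t / ρ (φ t) - 1) * (ρ (φ t) ^ (2 * n) - r t ^ (2 * n)) < 0 :=
        mul_neg_of_pos_of_neg (by linarith) (by linarith)
      exact ⟨this.le, fun _ => this⟩
  have hS'e : ∀ t, S' t = ((r t / ρ (φ t) - 1) * (ρ (φ t) ^ (2 * n) - r t ^ (2 * n))) *
      (2 * (r t / ρ (φ t)) * a * (Real.sin (φ t) ^ 2) * (Real.sin (φ t) ^ (2 * n)) /
      (1 + a * Real.sin (φ t) * Real.cos (φ t) *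
        (1 - (ρ (φ t) * Real.sin (φ t)) ^ (2 * n)))) := by
    intro t
    simp only [hS']
    generalize (1 + a * Real.sin (φ t) * Real.cos (φ t) *
        (1 - (ρ (φ t) * Real.sin (φ t)) ^ (2 * n))) = DD
    rw [mul_pow, mul_pow]
    ring
  have hfac : ∀ t, 0 ≤ (2 * (r t / ρ (φ t)) * a * (Real.sin (φ t) ^ 2) *
      (Real.sin (φ t) ^ (2 * n)) / (1 + a * Real.sin (φ t) * Real.cos (φ t) *
        (1 - (ρ (φ t) * Real.sin (φ t)) ^ (2 * n)))) := by
    intro t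
    apply div_nonneg _ (hD (φ t)).le
    have := hr t
    have := hρ (φ t)
    rw [pow_mul]
    positivity
  have hSanti : Antitone S := by
    apply antitone_of_deriv_nonpos (fun t => (hSd t).differentiableAt)
    intro t
    rw [(hSd t).deriv, hS'e]
    exact mul_nonpos_of_nonpos_of_nonneg (hsplit t).1 (hfac t)
  have hSper : Function.Periodic S T := by
    intro t
    simp only [hS, hrT, hρT]
  have hSconst : ∀ s t, S s = S t := by
    have hle : ∀ s t, S s ≤ S t := by
      intro s t
      obtain ⟨s', hs', hss⟩ := hSper.exists_mem_Ico hT s t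
      rw [hss]; exact hSanti hs'.1
    exact fun s t => le_antisymm (hle s t) (hle t s)
  have hS0 : ∀ t, S' t = 0 := by
    intro t
    have h1 : S = fun _ => S 0 := funext fun s => hSconst s 0
    have h2 := hSd t
    rw [h1] at h2
    exact h2.unique (hasDerivAt_const t (S 0))
  have hreq : ∀ t, r t = ρ (φ t) := by
    by_contra hcon
    push Not at hcon
    obtain ⟨t1, ht1⟩ := hcon
    have hne : ∀ t, r t ≠ ρ (φ t) := by
      intro t ht
      have h1 := hSconst t t1
      simp only [hS] at h1
      rw [ht, div_self (hρ _).ne', sub_self] at h1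
      have h2 : r t1 / ρ (φ t1) - 1 = 0 := by
        apply pow_eq_zero_iff (two_ne_zero) |>.1
        rw [← h1]; norm_num
      apply ht1
      have h3 : r t1 / ρ (φ t1) = 1 := by linarith
      exact (div_eq_one_iff_eq (hρ _).ne').1 h3
    have hs0 : ∀ t, Real.sin (φ t) = 0 := by
      intro t
      by_contra hq
      have h1 := hS0 t
      rw [hS'e] at h1
      have h2 := (hsplit t).2 (hne t)
      rcases mul_eq_zero.1 h1 with h3 | h3
      · linarith
      · have := (hr t).ne'
        have := (hρ (φ t)).ne'
        have := (hD (φ t)).ne'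
        revert h3
        positivity
    have hy0 : ∀ t, y t = 0 := by
      intro t; rw [hy, hs0]; simp
    have hyf : y = fun _ => 0 := funext hy0
    have h1 := (hs 0).2
    rw [hyf] at h1
    have h2 := h1.unique (hasDerivAt_const 0 0)
    have h3 := hE 0
    rw [hy0 0] at h3
    have h4 : x 0 = 0 := by simpa using h2
    rw [h4] at h3
    norm_num at h3
  ext p
  constructor
  · rintro ⟨t, rfl⟩
    exact ⟨φ t, by simp only; rw [← hreq, ← hx, ← hy]⟩
  · rintro ⟨θ, rfl⟩
    obtain ⟨t, rfl⟩ := hsurj θ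
    exact ⟨t, by simp only; rw [← hreq, ← hx, ← hy]⟩

theorem ray_unique_pos (n : ℕ) (hn : 0 < n) (a : ℝ) (ha : 0 < a) :
    ∃ Γ, IsPeriodicOrbitRayleigh n a Γ ∧ ∀ Γ', IsPeriodicOrbitRayleigh n a Γ' → Γ' = Γ := by
  obtain ⟨ρ, hρ, hD, hd, hper⟩ := ray_polar_exists n hn a ha
  refine ⟨_, ray_orbit_of_polar n a ρ hρ hD hd hper, ?_⟩
  rintro Γ' ⟨x, y, h, rfl⟩
  exact ray_orbit_eq n hn a ha ρ hρ hD hd hper x y h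

theorem ray_reflect (n : ℕ) (a : ℝ) (Γ : Set (ℝ × ℝ)) (h : IsPeriodicOrbitRayleigh n a Γ) :
    IsPeriodicOrbitRayleigh n (-a) ((fun p : ℝ × ℝ => (p.1, -p.2)) '' Γ) := by
  obtain ⟨x, y, ⟨hs, ⟨t₁, t₂, hne⟩, T, hT, hper⟩, rfl⟩ := h
  refine ⟨fun t => x (-t), fun t => -y (-t), ⟨fun t => ⟨?_, ?_⟩, ⟨-t₁, -t₂, ?_⟩, T, hT, ?_⟩, ?_⟩
  · refine ray_hd ((hs (-t)).1.comp t (hasDerivAt_neg t)) (fun _ => rfl) ?_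
    ring
  · refine ray_hd ((hs (-t)).2.comp t (hasDerivAt_neg t)).neg (fun _ => rfl) ?_
    rw [Even.neg_pow (even_two_mul n)]
    ring
  · intro h
    apply hne
    simpa using h
  · intro t
    have := hper (-(t + T))
    rw [show -(t + T) + T = -t by ring] at this
    simp only [Prod.mk.injEq] at this ⊢
    exact ⟨this.1.symm, by rw [this.2]⟩
  · rw [← range_comp]
    ext p
    constructor
    · rintro ⟨t, rfl⟩
      exact ⟨-t, by simp⟩
    · rintro ⟨t, rfl⟩
      exact ⟨-t, by simp⟩

theorem ray_unique_all (n : ℕ) (hn : 0 < n) (a : ℝ) (ha : a ≠ 0) :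
    ∃ Γ, IsPeriodicOrbitRayleigh n a Γ ∧ ∀ Γ', IsPeriodicOrbitRayleigh n a Γ' → Γ' = Γ := by
  rcases lt_or_gt_of_ne ha with h | h
  · obtain ⟨Γ, h1, h2⟩ := ray_unique_pos n hn (-a) (by linarith)
    refine ⟨_, by simpa using ray_reflect n (-a) Γ h1, ?_⟩
    intro Γ' h'
    rw [← h2 _ (ray_reflect n a Γ' h'), image_image]
    simp
  · exact ray_unique_pos n hn a h

/-- For every positive integer `n` and every real `a ≠ 0`, the generalized Rayleigh
system has exactly one limit cycle. -/
theorem rayleigh_unique_limit_cycle (n : ℕ) (hn : 0 < n) (a : ℝ) (ha : a ≠ 0) :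
    (∃ Γ : Set (ℝ × ℝ), IsLimitCycleRayleigh n a Γ) ∧
    ∀ Γ₁ Γ₂ : Set (ℝ × ℝ),
      IsLimitCycleRayleigh n a Γ₁ → IsLimitCycleRayleigh n a Γ₂ → Γ₁ = Γ₂ := by
  obtain ⟨Γ, h1, h2⟩ := ray_unique_all n hn a ha
  refine ⟨⟨Γ, h1, univ, isOpen_univ, subset_univ _, fun Γ' h' _ => h2 Γ' h'⟩, ?_⟩
  intro Γ₁ Γ₂ k1 k2
  rw [h2 _ k1.1, h2 _ k2.1]
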